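/- arXiv:1606.08896 — 4 statements merged into one kernel-verified Lean document; each statement's English description precedes it below -/
import Mathlib

section
/- (Lemma 3, clausal form rewriting.) Let l₁ and l₂ be lists of real numbers all lying in [0,1]. Then the Łukasiewicz disjunction of all entries of l₁ ++ l₂ equals the Łukasiewicz implication from the Łukasiewicz conjunction of the complements of the entries of l₁ to the Łukasiewicz disjunction of the entries of l₂; that is, List.foldr (fun x y => min (x + y) 1) 0 (l₁ ++ l₂) = min (1 − List.foldr (fun x y => max (x + y - 1) 0) 1 (l₁.map (fun x => 1 − x)) + List.foldr (fun x y => min (x + y) 1) 0 l₂) 1. -/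
/-- The Łukasiewicz disjunction of a list is at most `1`. -/
theorem foldr_tconorm_le_one (l : List ℝ) :
    List.foldr (fun x y => min (x + y) 1) 0 l ≤ 1 := by
  cases l with
  | nil => simp
  | cons x l => exact min_le_right _ _

/-- The Łukasiewicz disjunction of nonnegative reals is nonnegative. -/
theorem foldr_tconorm_nonneg (l : List ℝ) (hl : ∀ x ∈ l, 0 ≤ x) :
    0 ≤ List.foldr (fun x y => min (x + y) 1) 0 l := by
  induction l with
  | nil => simp
  | cons x l ih =>
    rw [List.forall_mem_cons] at hl
    exact le_min (add_nonneg hl.1 (ih hl.2)) zero_le_one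

/-- De Morgan duality between the Łukasiewicz conjunction and disjunction of a list. -/
theorem one_sub_foldr_tnorm_map_one_sub (l : List ℝ) :
    1 - List.foldr (fun x y => max (x + y - 1) 0) 1 (l.map (fun x => 1 - x)) =
      List.foldr (fun x y => min (x + y) 1) 0 l := by
  induction l with
  | nil => simp
  | cons x l ih =>
    simp only [List.map_cons, List.foldr_cons]
    rw [← ih, ← min_sub_sub_left]
    congr 1 <;> ring

/-- The Łukasiewicz disjunction of a concatenation is the disjunction of the two disjunctions. -/
theorem foldr_tconorm_append (l₁ l₂ : List ℝ) (hl₁ : ∀ x ∈ l₁, 0 ≤ x) (hl₂ : ∀ x ∈ l₂, 0 ≤ x) :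
    List.foldr (fun x y => min (x + y) 1) 0 (l₁ ++ l₂) =
      min (List.foldr (fun x y => min (x + y) 1) 0 l₁ +
        List.foldr (fun x y => min (x + y) 1) 0 l₂) 1 := by
  induction l₁ with
  | nil => simpa using foldr_tconorm_le_one l₂
  | cons x l ih =>
    rw [List.forall_mem_cons] at hl₁
    have hb := foldr_tconorm_nonneg l₂ hl₂
    simp only [List.cons_append, List.foldr_cons]
    rw [ih hl₁.2]
    grind

/-- Lemma 3: clausal form rewriting for Łukasiewicz operators. -/
theorem lukasiewicz_clausal_rewriting (l₁ l₂ : List ℝ)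
    (hl₁ : ∀ x ∈ l₁, x ∈ Set.Icc (0 : ℝ) 1)
    (hl₂ : ∀ x ∈ l₂, x ∈ Set.Icc (0 : ℝ) 1) :
    List.foldr (fun x y => min (x + y) 1) 0 (l₁ ++ l₂) =
      min (1 - List.foldr (fun x y => max (x + y - 1) 0) 1
              (l₁.map (fun x => 1 - x)) +
            List.foldr (fun x y => min (x + y) 1) 0 l₂) 1 := by
  rw [one_sub_foldr_tnorm_map_one_sub]
  exact foldr_tconorm_append l₁ l₂ (fun x hx => (hl₁ x hx).1) (fun x hx => (hl₂ x hx).1)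
end

section
/- (Theorem 2.) Let σ be a type of atoms, ι a finite index set, and for each i ∈ ι let wᵢ be a real weight, kᵢ ∈ {1,2}, and Fᵢ a fuzzy propositional formula over σ whose numeric constants are restricted to 0 and 1. Let fneg, fconj, fdisj, fimp be fuzzy operators that generalize the Boolean connectives (they agree with Boolean negation, conjunction, disjunction, and implication on arguments in {0,1}). Let J : σ → ℝ be a Boolean fuzzy interpretation (J p ∈ {0,1} for all p) and I : σ → Bool the corresponding classical interpretation, I p = (J p = 1). Then the Markov Logic weight of I equals the total weight times the generalized-PSL unnormalized density of J: exp(∑_{i : I ⊨ Fᵢ} wᵢ) = exp(∑_{i∈ι} wᵢ) · exp(−∑_{i∈ι} wᵢ · (1 − v_J(Fᵢ))^{kᵢ}). -/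
/-- Fuzzy propositional formulas over an atom type `σ`. -/
inductive FuzzyFormula (σ : Type*) where
  | atom  : σ → FuzzyFormula σ
  | const : ℝ → FuzzyFormula σ
  | neg   : FuzzyFormula σ → FuzzyFormula σ
  | conj  : FuzzyFormula σ → FuzzyFormula σ → FuzzyFormula σ
  | disj  : FuzzyFormula σ → FuzzyFormula σ → FuzzyFormula σ
  | imp   : FuzzyFormula σ → FuzzyFormula σ → FuzzyFormula σ

/-- The fuzzy truth value of a formula under a fuzzy interpretation `J`,
given fuzzy operators `fneg`, `fconj`, `fdisj`, `fimp`. -/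
def fuzzyVal {σ : Type*} (fneg : ℝ → ℝ) (fconj fdisj fimp : ℝ → ℝ → ℝ)
    (J : σ → ℝ) : FuzzyFormula σ → ℝ
  | .atom p   => J p
  | .const c  => c
  | .neg F    => fneg (fuzzyVal fneg fconj fdisj fimp J F)
  | .conj F G => fconj (fuzzyVal fneg fconj fdisj fimp J F)
                       (fuzzyVal fneg fconj fdisj fimp J G)
  | .disj F G => fdisj (fuzzyVal fneg fconj fdisj fimp J F)
                       (fuzzyVal fneg fconj fdisj fimp J G)
  | .imp F G  => fimp (fuzzyVal fneg fconj fdisj fimp J F)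
                      (fuzzyVal fneg fconj fdisj fimp J G)

/-- Classical satisfaction of a fuzzy formula by a Boolean interpretation;
the constant `1` is satisfied and all other constants are not. -/
def classSat {σ : Type*} (I : σ → Bool) : FuzzyFormula σ → Prop
  | .atom p   => I p = true
  | .const c  => c = 1
  | .neg F    => ¬ classSat I F
  | .conj F G => classSat I F ∧ classSat I G
  | .disj F G => classSat I F ∨ classSat I G
  | .imp F G  => classSat I F → classSat I G

/-- All numeric constants occurring in the formula are 0 or 1. -/
def boolConsts {σ : Type*} : FuzzyFormula σ → Prop
  | .atom _   => True
  | .const c  => c = 0 ∨ c = 1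
  | .neg F    => boolConsts F
  | .conj F G => boolConsts F ∧ boolConsts G
  | .disj F G => boolConsts F ∧ boolConsts G
  | .imp F G  => boolConsts F ∧ boolConsts G

/-- On Boolean interpretations, operators that generalize the Boolean connectives give truth
value `1` to the satisfied formulas and `0` to the others. -/
theorem fuzzyVal_eq_one_or_zero {σ : Type*}
    (fneg : ℝ → ℝ) (fconj fdisj fimp : ℝ → ℝ → ℝ)
    (hneg0 : fneg 0 = 1) (hneg1 : fneg 1 = 0)
    (hconj11 : fconj 1 1 = 1) (hconj00 : fconj 0 0 = 0)
    (hconj01 : fconj 0 1 = 0) (hconj10 : fconj 1 0 = 0)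
    (hdisj00 : fdisj 0 0 = 0) (hdisj01 : fdisj 0 1 = 1)
    (hdisj10 : fdisj 1 0 = 1) (hdisj11 : fdisj 1 1 = 1)
    (himp10 : fimp 1 0 = 0) (himp00 : fimp 0 0 = 1)
    (himp01 : fimp 0 1 = 1) (himp11 : fimp 1 1 = 1)
    (J : σ → ℝ) (hJ : ∀ p, J p = 0 ∨ J p = 1)
    (I : σ → Bool) (hI : ∀ p, I p = true ↔ J p = 1)
    (F : FuzzyFormula σ) (hF : boolConsts F) :
    (classSat I F ∧ fuzzyVal fneg fconj fdisj fimp J F = 1) ∨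
      (¬ classSat I F ∧ fuzzyVal fneg fconj fdisj fimp J F = 0) := by
  induction F with
  | atom p =>
    simp only [classSat, fuzzyVal, hI]
    rcases hJ p with h | h <;> simp [h]
  | const c =>
    simp only [classSat, fuzzyVal]
    rcases hF with h | h <;> simp [h]
  | neg F ih =>
    simp only [classSat, fuzzyVal]
    rcases ih hF with ⟨h, e⟩ | ⟨h, e⟩ <;> simp [h, e, hneg0, hneg1]
  | conj F G ihF ihG =>
    simp only [classSat, fuzzyVal]
    rcases ihF hF.1 with ⟨h, e⟩ | ⟨h, e⟩ <;> rcases ihG hF.2 with ⟨h', e'⟩ | ⟨h', e'⟩ <;>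
      simp [h, e, h', e', hconj00, hconj01, hconj10, hconj11]
  | disj F G ihF ihG =>
    simp only [classSat, fuzzyVal]
    rcases ihF hF.1 with ⟨h, e⟩ | ⟨h, e⟩ <;> rcases ihG hF.2 with ⟨h', e'⟩ | ⟨h', e'⟩ <;>
      simp [h, e, h', e', hdisj00, hdisj01, hdisj10, hdisj11]
  | imp F G ihF ihG =>
    simp only [classSat, fuzzyVal]
    rcases ihF hF.1 with ⟨h, e⟩ | ⟨h, e⟩ <;> rcases ihG hF.2 with ⟨h', e'⟩ | ⟨h', e'⟩ <;>
      simp [h, e, h', e', himp00, himp01, himp10, himp11]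

open scoped Classical in
/-- Theorem 2: the Markov Logic weight of a Boolean interpretation equals the
total weight times the generalized-PSL unnormalized density of the
corresponding Boolean fuzzy interpretation. -/
theorem mln_weight_eq_total_mul_gpsl_density {σ : Type*} {ι : Type*} [Fintype ι]
    (fneg : ℝ → ℝ) (fconj fdisj fimp : ℝ → ℝ → ℝ)
    (hneg0 : fneg 0 = 1) (hneg1 : fneg 1 = 0)
    (hconj11 : fconj 1 1 = 1) (hconj00 : fconj 0 0 = 0)
    (hconj01 : fconj 0 1 = 0) (hconj10 : fconj 1 0 = 0)
    (hdisj00 : fdisj 0 0 = 0) (hdisj01 : fdisj 0 1 = 1)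
    (hdisj10 : fdisj 1 0 = 1) (hdisj11 : fdisj 1 1 = 1)
    (himp10 : fimp 1 0 = 0) (himp00 : fimp 0 0 = 1)
    (himp01 : fimp 0 1 = 1) (himp11 : fimp 1 1 = 1)
    (w : ι → ℝ) (k : ι → ℕ) (hk : ∀ i, k i = 1 ∨ k i = 2)
    (F : ι → FuzzyFormula σ) (hF : ∀ i, boolConsts (F i))
    (J : σ → ℝ) (hJ : ∀ p, J p = 0 ∨ J p = 1)
    (I : σ → Bool) (hI : ∀ p, I p = true ↔ J p = 1) :
    Real.exp (∑ i ∈ Finset.univ.filter (fun i => classSat I (F i)), w i) =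
      Real.exp (∑ i, w i) *
        Real.exp (-∑ i,
          w i * (1 - fuzzyVal fneg fconj fdisj fimp J (F i)) ^ (k i)) := by
  rw [← Real.exp_add, ← sub_eq_add_neg, ← Finset.sum_sub_distrib, Finset.sum_filter]
  congr 1
  refine Finset.sum_congr rfl fun i _ => ?_
  have hki : k i ≠ 0 := by rcases hk i with h | h <;> simp [h]
  rcases fuzzyVal_eq_one_or_zero fneg fconj fdisj fimp hneg0 hneg1 hconj11 hconj00 hconj01
    hconj10 hdisj00 hdisj01 hdisj10 hdisj11 himp10 himp00 himp01 himp11 J hJ I hI (F i) (hF i)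
    with ⟨h, e⟩ | ⟨h, e⟩ <;> simp [h, e, hki]
end

section
/- (Corollary 1, PSL density versus MLN weight on Boolean interpretations.) Let ι be a finite index set, and for each i ∈ ι let wᵢ ≥ 0 be a real weight, kᵢ ∈ {1,2}, aᵢ ∈ {0,1} the (Boolean) head value of rule i, and tᵢ ∈ {0,1} the (Boolean) body value of rule i. Then exp(−∑_{i∈ι} wᵢ · (max 0 (tᵢ − aᵢ))^{kᵢ}) = exp(∑_{i : tᵢ ≤ aᵢ} wᵢ) / exp(∑_{i∈ι} wᵢ); that is, the unnormalized PSL density of a Boolean interpretation equals the MLN weight of that interpretation (where rule i is classically satisfied exactly when tᵢ ≤ aᵢ) divided by the total weight exp(∑ᵢ wᵢ). -/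
open scoped Classical in
/-- Corollary 1: on Boolean interpretations, the unnormalized PSL density
equals the MLN weight divided by the total weight. -/
theorem psl_density_eq_mln_weight_div_total {ι : Type*} [Fintype ι]
    (w : ι → ℝ) (hw : ∀ i, 0 ≤ w i)
    (k : ι → ℕ) (hk : ∀ i, k i = 1 ∨ k i = 2)
    (a : ι → ℝ) (ha : ∀ i, a i = 0 ∨ a i = 1)
    (t : ι → ℝ) (ht : ∀ i, t i = 0 ∨ t i = 1) :
    Real.exp (-∑ i, w i * (max 0 (t i - a i)) ^ (k i)) =
      Real.exp (∑ i ∈ Finset.univ.filter (fun i => t i ≤ a i), w i) /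
        Real.exp (∑ i, w i) := by
  rw [← Real.exp_sub, Finset.sum_filter, ← Finset.sum_sub_distrib, ← Finset.sum_neg_distrib]
  congr 1
  refine Finset.sum_congr rfl fun i _ => ?_
  rcases hk i with hk | hk <;> rcases ha i with ha | ha <;> rcases ht i with ht | ht <;>
    norm_num [hk, ha, ht]
end

section
/- (Core of Theorem 3: Boolean interpretations eventually dominate non-Boolean ones.) Let σ be a finite set of atoms. Let J : σ → ℝ satisfy J p ∈ [0,1] for all p ∈ σ and J p ∉ {0,1} for some p ∈ σ, and let I : σ → ℝ satisfy I p ∈ {0,1} for all p ∈ σ. Let W_J and W_I be real numbers (the contributions of the original weighted formulas to the density exponents of J and I respectively), and let c(J) = ∑_{p ∈ σ} (1 − min (1 − min (J p + J p) 1 + J p) 1) and c(I) = ∑_{p ∈ σ} (1 − min (1 − min (I p + I p) 1 + I p) 1). Then c(I) = 0, and there exists α₀ such that for all α ≥ α₀, exp(W_J − α · c(J)) < exp(W_I − α · c(I)); that is, for sufficiently large crispifying weight α, the unnormalized density of every non-Boolean interpretation is strictly smaller than that of every Boolean interpretation. -/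
/-- The distance to satisfaction of the crispifying formula is nonnegative. -/
theorem crsp_dist_nonneg (x : ℝ) : 0 ≤ 1 - min (1 - min (x + x) 1 + x) 1 :=
  sub_nonneg.2 (min_le_right _ _)

/-- A Boolean truth value satisfies the crispifying formula. -/
theorem crsp_dist_eq_zero {x : ℝ} (hx : x = 0 ∨ x = 1) :
    1 - min (1 - min (x + x) 1 + x) 1 = 0 := by
  rcases hx with rfl | rfl <;> norm_num

/-- A truth value strictly between `0` and `1` violates the crispifying formula. -/
theorem crsp_dist_pos {x : ℝ} (h0 : 0 < x) (h1 : x < 1) :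
    0 < 1 - min (1 - min (x + x) 1 + x) 1 := by
  have h : x < min (x + x) 1 := lt_min (by linarith) h1
  exact sub_pos.2 (min_lt_of_left_lt (by linarith))

/-- Core of Theorem 3: for sufficiently large crispifying weight, the
unnormalized density of every non-Boolean interpretation is strictly smaller
than that of every Boolean interpretation. -/
theorem boolean_dominates_nonBoolean {σ : Type*} [Fintype σ]
    (J : σ → ℝ) (hJ : ∀ p, J p ∈ Set.Icc (0 : ℝ) 1)
    (hnb : ∃ p, J p ≠ 0 ∧ J p ≠ 1)
    (I : σ → ℝ) (hI : ∀ p, I p = 0 ∨ I p = 1)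
    (W_J W_I : ℝ) :
    (∑ p, (1 - min (1 - min (I p + I p) 1 + I p) 1)) = 0 ∧
      ∃ α₀ : ℝ, ∀ α ≥ α₀,
        Real.exp (W_J - α * ∑ p, (1 - min (1 - min (J p + J p) 1 + J p) 1)) <
          Real.exp (W_I - α * ∑ p, (1 - min (1 - min (I p + I p) 1 + I p) 1)) := by
  have hcI : (∑ p, (1 - min (1 - min (I p + I p) 1 + I p) 1)) = 0 :=
    Finset.sum_eq_zero fun p _ => crsp_dist_eq_zero (hI p)
  obtain ⟨q, hq0, hq1⟩ := hnb
  have hcJ : 0 < ∑ p, (1 - min (1 - min (J p + J p) 1 + J p) 1) :=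
    Finset.sum_pos' (fun p _ => crsp_dist_nonneg (J p))
      ⟨q, Finset.mem_univ q,
        crsp_dist_pos ((hJ q).1.lt_of_ne' hq0) ((hJ q).2.lt_of_ne hq1)⟩
  refine ⟨hcI, (W_J - W_I + 1) / ∑ p, (1 - min (1 - min (J p + J p) 1 + J p) 1),
    fun α hα => Real.exp_lt_exp.2 ?_⟩
  rw [hcI]
  have h := (div_le_iff₀ hcJ).1 hα
  linarith
end
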